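/- Under the Gaussian linear-regression model, for every p ∈ [1, ∞] with dual exponent q, every ε ≥ 0 and every θ ∈ ℝᵐ, the adversarial loss satisfies L_{p,ε}(θ) = σ_θ² + ε²·‖θ‖_q² + 2·c₁·ε·‖θ‖_q·σ_θ, where c₁ = √(2/π). -/

import Mathlib

open MeasureTheory ProbabilityTheory
open scoped Matrix ENNReal

/-- The `ℓ_p` norm of a vector in `ℝᵐ`, via Mathlib's `PiLp` norm. -/
noncomputable def lpNorm {m : ℕ} (p : ℝ≥0∞) (x : Fin m → ℝ) : ℝ :=
  ‖(WithLp.equiv p (Fin m → ℝ)).symm x‖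

/-- A random vector `X : Ω → ℝᵐ` has the centered multivariate Gaussian law `N(0, S)`
(with `S` positive semidefinite) iff every linear functional of it is a centered real
Gaussian with the corresponding variance. -/
def HasCenteredGaussianLaw {Ω : Type*} [MeasurableSpace Ω] (μ : Measure Ω) {m : ℕ}
    (X : Ω → Fin m → ℝ) (S : Matrix (Fin m) (Fin m) ℝ) : Prop :=
  ∀ a : Fin m → ℝ,
    Measure.map (fun ω => X ω ⬝ᵥ a) μ = gaussianReal 0 (a ⬝ᵥ S.mulVec a).toNNReal

theorem lpNorm_smul {m : ℕ} {p : ℝ≥0∞} (hp : 1 ≤ p) (c : ℝ) (x : Fin m → ℝ) :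
    lpNorm p (c • x) = |c| * lpNorm p x := by
  have : Fact (1 ≤ p) := ⟨hp⟩
  exact norm_smul c (WithLp.toLp p x)

theorem lpNorm_top {m : ℕ} (x : Fin m → ℝ) : lpNorm ∞ x = ⨆ i, |x i| := rfl

theorem lpNorm_one {m : ℕ} (x : Fin m → ℝ) : lpNorm 1 x = ∑ i, |x i| :=
  PiLp.norm_eq_of_L1 (WithLp.toLp 1 x)

theorem lpNorm_eq_sum {m : ℕ} {p : ℝ≥0∞} (hp : 0 < p.toReal) (x : Fin m → ℝ) :
    lpNorm p x = (∑ i, |x i| ^ p.toReal) ^ (1 / p.toReal) :=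
  PiLp.norm_eq_sum hp (WithLp.toLp p x)

theorem lpNorm_nonneg {m : ℕ} {p : ℝ≥0∞} (hp : 1 ≤ p) (x : Fin m → ℝ) : 0 ≤ lpNorm p x := by
  have : Fact (1 ≤ p) := ⟨hp⟩
  exact norm_nonneg (WithLp.toLp p x)

theorem dotProduct_le_sum_abs_mul_iSup_abs {m : ℕ} (x y : Fin m → ℝ) :
    x ⬝ᵥ y ≤ (∑ i, |x i|) * ⨆ i, |y i| := by
  rw [dotProduct, Finset.sum_mul]
  refine Finset.sum_le_sum fun i _ => (le_abs_self _).trans ?_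
  rw [abs_mul]
  exact mul_le_mul_of_nonneg_left
    (le_ciSup (f := fun i => |y i|) (Set.finite_range _).bddAbove i) (abs_nonneg _)

/-- Hölder's inequality for `lpNorm`. -/
theorem dotProduct_le_lpNorm_mul_lpNorm {m : ℕ} {p q : ℝ≥0∞} (hpq : p.HolderConjugate q)
    (x y : Fin m → ℝ) : x ⬝ᵥ y ≤ lpNorm p x * lpNorm q y := by
  rcases eq_or_ne p ∞ with rfl | hp
  · obtain rfl : q = 1 := by simpa using ENNReal.holderConjugate_iff.1 hpq
    rw [lpNorm_top, lpNorm_one, mul_comm, dotProduct_comm]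
    exact dotProduct_le_sum_abs_mul_iSup_abs y x
  rcases eq_or_ne q ∞ with rfl | hq
  · obtain rfl : p = 1 := by simpa using ENNReal.holderConjugate_iff.1 hpq
    rw [lpNorm_top, lpNorm_one]
    exact dotProduct_le_sum_abs_mul_iSup_abs x y
  have h := ENNReal.HolderConjugate.toReal_of_ne_top hp hq
  rw [lpNorm_eq_sum h.pos, lpNorm_eq_sum h.symm.pos]
  exact Real.inner_le_Lp_mul_Lq _ x y h

/-- The `ℓ_q` norm of a vector is attained by pairing it with a point of the `ℓ_p` unit ball. -/
theorem exists_lpNorm_le_one_dotProduct_eq {m : ℕ} {p q : ℝ≥0∞}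
    (hpq : p.HolderConjugate q) (y : Fin m → ℝ) :
    ∃ x : Fin m → ℝ, lpNorm p x ≤ 1 ∧ x ⬝ᵥ y = lpNorm q y := by
  have hsign (t : ℝ) : |((SignType.sign t : SignType) : ℝ)| ≤ 1 := by
    rcases lt_trichotomy t 0 with h | h | h <;> simp [h]
  rcases eq_or_ne p ∞ with rfl | hp
  · obtain rfl : q = 1 := by simpa using ENNReal.holderConjugate_iff.1 hpq
    refine ⟨fun i => SignType.sign (y i), ?_, ?_⟩
    · rw [lpNorm_top]
      exact Real.iSup_le (fun i => hsign _) zero_le_one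
    · simp [lpNorm_one, dotProduct, sign_mul_self]
  rcases eq_or_ne q ∞ with rfl | hq
  · obtain rfl : p = 1 := by simpa using ENNReal.holderConjugate_iff.1 hpq
    rcases isEmpty_or_nonempty (Fin m) with hm | hm
    · exact ⟨0, by simp [lpNorm_one], by simp [lpNorm_top, dotProduct]⟩
    obtain ⟨i, hi⟩ := exists_eq_ciSup_of_finite (f := fun i => |y i|)
    refine ⟨Pi.single i (SignType.sign (y i) : ℝ), ?_, ?_⟩
    · rw [lpNorm_one, Finset.sum_eq_single i (fun j _ hj => by simp [hj]) (by simp)]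
      simpa using hsign (y i)
    · rw [lpNorm_top, ← hi, single_dotProduct, sign_mul_self]
  have h := ENNReal.HolderConjugate.toReal_of_ne_top hp hq
  obtain ⟨g, hg, hgy⟩ := (NNReal.isGreatest_Lp Finset.univ (fun i => ‖y i‖₊) h.symm).1
  refine ⟨fun i => SignType.sign (y i) * g i, ?_, ?_⟩
  · rw [lpNorm_eq_sum h.pos]
    refine Real.rpow_le_one (Finset.sum_nonneg fun i _ => by positivity) ?_ h.one_div_nonneg
    have hg' : ∑ i, (g i : ℝ) ^ p.toReal ≤ 1 := mod_cast hg
    refine le_trans (Finset.sum_le_sum fun i _ => ?_) hg'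
    rw [abs_mul, abs_of_nonneg (g i).coe_nonneg]
    exact Real.rpow_le_rpow (by positivity) (mul_le_of_le_one_left (g i).coe_nonneg (hsign _))
      h.nonneg
  · rw [lpNorm_eq_sum h.symm.pos]
    have := congrArg NNReal.toReal hgy
    push_cast at this
    simp only [Real.norm_eq_abs] at this
    rw [← this, dotProduct]
    refine Finset.sum_congr rfl fun i _ => ?_
    rw [← sign_mul_self]; ring

/-- The worst-case squared residual under an `ℓ_p`-bounded perturbation. -/
theorem isGreatest_sq_sub_dotProduct {m : ℕ} {p q : ℝ≥0∞} (hp : 1 ≤ p)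
    (hpq : p.HolderConjugate q) {ε : ℝ} (hε : 0 ≤ ε) (θ : Fin m → ℝ) (r : ℝ) :
    IsGreatest {z : ℝ | ∃ δ : Fin m → ℝ, lpNorm p δ ≤ ε ∧ z = (r - δ ⬝ᵥ θ) ^ 2}
      ((|r| + ε * lpNorm q θ) ^ 2) := by
  have hq : 1 ≤ q := hpq.symm.one_le
  constructor
  · obtain ⟨x, hx, hxθ⟩ := exists_lpNorm_le_one_dotProduct_eq hpq θ
    rcases le_total 0 r with hr | hr
    · refine ⟨(-ε) • x, ?_, ?_⟩
      · rw [lpNorm_smul hp, abs_neg, abs_of_nonneg hε]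
        exact mul_le_of_le_one_right hε hx
      · rw [smul_dotProduct, hxθ, abs_of_nonneg hr, smul_eq_mul]; ring
    · refine ⟨ε • x, ?_, ?_⟩
      · rw [lpNorm_smul hp, abs_of_nonneg hε]
        exact mul_le_of_le_one_right hε hx
      · rw [smul_dotProduct, hxθ, abs_of_nonpos hr, smul_eq_mul]; ring
  · rintro _ ⟨δ, hδ, rfl⟩
    have hN := lpNorm_nonneg hq θ
    have h₁ := dotProduct_le_lpNorm_mul_lpNorm hpq δ θ
    have h₂ := dotProduct_le_lpNorm_mul_lpNorm hpq ((-1 : ℝ) • δ) θ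
    rw [lpNorm_smul hp, smul_dotProduct, abs_neg, abs_one, one_mul, neg_one_smul] at h₂
    have h₃ := mul_le_mul_of_nonneg_right hδ hN
    have h₄ : |δ ⬝ᵥ θ| ≤ ε * lpNorm q θ := abs_le.2 ⟨by linarith, by linarith⟩
    rw [← sq_abs (r - δ ⬝ᵥ θ)]
    exact pow_le_pow_left₀ (abs_nonneg _) ((abs_sub _ _).trans (by linarith)) 2

/-- The first absolute moment of a centered real Gaussian. -/
theorem integral_abs_gaussianReal {v : NNReal} (hv : v ≠ 0) :
    ∫ x, |x| ∂gaussianReal 0 v = √(2 / Real.pi) * √v := by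
  have hv' : (0 : ℝ) < v := by positivity
  have key : ∫ x in Set.Ioi (0 : ℝ), x * Real.exp (-(1 / (2 * v)) * x ^ 2) = v := by
    have := integral_rpow_mul_exp_neg_mul_rpow (p := 2) (q := 1) (b := 1 / (2 * v))
      two_pos (by norm_num) (by positivity)
    norm_num [Real.rpow_neg_one] at this
    rw [show (2 * v * (1 / 2) : ℝ) = v by ring] at this
    simpa using this
  rw [integral_gaussianReal_eq_integral_smul hv]
  have h : ∀ x : ℝ, gaussianPDFReal 0 v x • |x| =
      (√(2 * Real.pi * v))⁻¹ * (|x| * Real.exp (-(1 / (2 * v)) * |x| ^ 2)) := by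
    intro x
    rw [gaussianPDFReal, sq_abs, smul_eq_mul, sub_zero]
    ring_nf
  simp_rw [h]
  rw [integral_const_mul, integral_comp_abs (f := fun x => x * Real.exp (-(1 / (2 * v)) * x ^ 2)),
    key, ← Real.sqrt_mul (by positivity), inv_mul_eq_div, div_eq_iff (by positivity),
    ← Real.sqrt_mul (by positivity)]
  symm
  rw [Real.sqrt_eq_iff_mul_self_eq (by positivity) (by positivity)]
  field_simp

/-- The second moment of a shifted absolute value of a centered real Gaussian. -/
theorem integral_abs_add_sq_gaussianReal {v : NNReal} (hv : v ≠ 0) (c : ℝ) :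
    ∫ x, (|x| + c) ^ 2 ∂gaussianReal 0 v = v + c ^ 2 + 2 * √(2 / Real.pi) * c * √v := by
  have h1 : Integrable (fun x : ℝ => |x|) (gaussianReal 0 v) :=
    ((memLp_id_gaussianReal 1).integrable (by norm_num)).abs
  have h2 : Integrable (fun x : ℝ => x ^ 2) (gaussianReal 0 v) :=
    (memLp_id_gaussianReal 2).integrable_sq
  have hvar : ∫ x : ℝ, x ^ 2 ∂gaussianReal 0 v = v := by
    rw [← variance_id_gaussianReal (μ := 0) (v := v),
      variance_of_integral_eq_zero aemeasurable_id (by simp)]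
    rfl
  have h : ∀ x : ℝ, (|x| + c) ^ 2 = x ^ 2 + 2 * c * |x| + c ^ 2 := fun x => by
    rw [← sq_abs x]; ring
  simp_rw [h]
  rw [integral_add (f := fun x : ℝ => x ^ 2 + 2 * c * |x|) (h2.add (h1.const_mul _))
      (integrable_const _),
    integral_add h2 (h1.const_mul _), integral_const_mul, hvar, integral_abs_gaussianReal hv]
  simp
  ring

/-- In the Gaussian linear-regression model, for every `p ∈ [1,∞]` with dual exponent `q`,
`ε ≥ 0` and `θ ∈ ℝᵐ`, the adversarial loss
`L_{p,ε}(θ) = E[sup_{‖δ‖_p ≤ ε} (Y − ⟨X + δ, θ⟩)²]` satisfies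
`L_{p,ε}(θ) = σ_θ² + ε²·‖θ‖_q² + 2·c₁·ε·‖θ‖_q·σ_θ`, where `c₁ = √(2/π)` and
`σ_θ = sqrt((θ − θopt)ᵀ Σ (θ − θopt) + σ_w²)`. -/
theorem adv_loss_expansion {Ω : Type*} [MeasurableSpace Ω]
    (μ : Measure Ω) [IsProbabilityMeasure μ] {m : ℕ} (hm : 0 < m)
    (S : Matrix (Fin m) (Fin m) ℝ) (hS : S.PosSemidef)
    (θopt : Fin m → ℝ) (σw : ℝ) (hσw : 0 < σw)
    (X : Ω → Fin m → ℝ) (hXmeas : Measurable X)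
    (W : Ω → ℝ) (hWmeas : Measurable W)
    (hX : HasCenteredGaussianLaw μ X S)
    (hW : Measure.map W μ = gaussianReal 0 ⟨σw ^ 2, sq_nonneg σw⟩)
    (hindep : IndepFun X W μ)
    (Y : Ω → ℝ) (hY : ∀ ω, Y ω = X ω ⬝ᵥ θopt + W ω)
    (p q : ℝ≥0∞) (hp : 1 ≤ p) (hpq : 1 / p + 1 / q = 1)
    (ε : ℝ) (hε : 0 ≤ ε) (θ : Fin m → ℝ) :
    ∫ ω, sSup {z : ℝ | ∃ δ : Fin m → ℝ,
        lpNorm p δ ≤ ε ∧ z = (Y ω - (X ω + δ) ⬝ᵥ θ) ^ 2} ∂μ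
      = Real.sqrt ((θ - θopt) ⬝ᵥ S.mulVec (θ - θopt) + σw ^ 2) ^ 2
          + ε ^ 2 * lpNorm q θ ^ 2
          + 2 * Real.sqrt (2 / Real.pi) * ε * lpNorm q θ
              * Real.sqrt ((θ - θopt) ⬝ᵥ S.mulVec (θ - θopt) + σw ^ 2) := by

  have hpq' : p.HolderConjugate q := ENNReal.holderConjugate_iff.2 (by simpa using hpq)
  set s : ℝ := (θ - θopt) ⬝ᵥ S.mulVec (θ - θopt) with hs
  have hs0 : 0 ≤ s := hS.dotProduct_mulVec_nonneg (θ - θopt)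
  have hsup : ∀ ω, sSup {z : ℝ | ∃ δ : Fin m → ℝ,
      lpNorm p δ ≤ ε ∧ z = (Y ω - (X ω + δ) ⬝ᵥ θ) ^ 2} =
      (|X ω ⬝ᵥ (θopt - θ) + W ω| + ε * lpNorm q θ) ^ 2 := fun ω => by
    rw [← (isGreatest_sq_sub_dotProduct hp hpq' hε θ _).csSup_eq]
    simp only [hY, add_dotProduct, dotProduct_sub]
    ring_nf
  simp_rw [hsup]
  have hmeas : Measurable fun x : Fin m → ℝ => x ⬝ᵥ (θopt - θ) := by
    unfold dotProduct; fun_prop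
  have hlaw : Measure.map (fun ω => X ω ⬝ᵥ (θopt - θ) + W ω) μ =
      gaussianReal 0 (s + σw ^ 2).toNNReal := by
    have hXθ := hX (θopt - θ)
    rw [← neg_sub θ θopt, Matrix.mulVec_neg, neg_dotProduct_neg, ← hs, neg_sub] at hXθ
    have h := gaussianReal_add_gaussianReal_of_indepFun (hindep.comp hmeas measurable_id) hXθ hW
    rw [add_zero] at h
    rw [Real.toNNReal_add hs0 (sq_nonneg σw), Real.toNNReal_of_nonneg (sq_nonneg σw)]
    exact h
  have hv : (s + σw ^ 2).toNNReal ≠ 0 := by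
    rw [Ne, Real.toNNReal_eq_zero, not_le]; positivity
  rw [← integral_map (φ := fun ω => X ω ⬝ᵥ (θopt - θ) + W ω)
    (f := fun x : ℝ => (|x| + ε * lpNorm q θ) ^ 2)
    ((hmeas.comp hXmeas).add hWmeas).aemeasurable (by fun_prop), hlaw,
    integral_abs_add_sq_gaussianReal hv, Real.coe_toNNReal _ (by positivity),
    Real.sq_sqrt (by positivity)]
  ring
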